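/- arXiv:2507.12250 — 4 statements merged into one kernel-verified Lean document; each statement's English description precedes it below -/
import Mathlib

section
/- For every natural number n ≥ 1 and every real number x, ∏_{j=0}^{n-1} (x + n - j) = ∏_{j=0}^{n-1} (x - j) + ∑_{k=1}^{n} k! · (binomial(n, k))² · ∏_{j=0}^{n-k-1} (x - j), where an empty product equals 1. -/
theorem Polynomial.descPochhammer_smeval_eq_prod_range {R : Type*} [CommRing R] (n : ℕ) (r : R) :
    (descPochhammer ℤ n).smeval r = ∏ j ∈ Finset.range n, (r - j) := by
  rw [← Polynomial.aeval_eq_smeval, ← descPochhammer_eval_eq_prod_range,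
    ← descPochhammer_map (algebraMap ℤ R), Polynomial.eval_map_algebraMap]

/-- For every `n ≥ 1` and every real `x`,
`∏_{j=0}^{n-1} (x + n - j) = ∏_{j=0}^{n-1} (x - j) +
  ∑_{k=1}^{n} k! · C(n,k)² · ∏_{j=0}^{n-k-1} (x - j)`,
the Cahill–Glauber identity evaluated on the spectrum of the number operator. -/
theorem cahill_glauber_polynomial_identity
    (n : ℕ) (hn : 1 ≤ n) (x : ℝ) :
    ∏ j ∈ Finset.range n, (x + n - j) =
      ∏ j ∈ Finset.range n, (x - j) +
        ∑ k ∈ Finset.Icc 1 n,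
          (k.factorial : ℝ) * (n.choose k : ℝ) ^ 2 *
            ∏ j ∈ Finset.range (n - k), (x - j) := by
  have h := Ring.descPochhammer_smeval_add n (Commute.all (n : ℝ) x)
  simp_rw [Polynomial.descPochhammer_smeval_eq_descFactorial,
    Polynomial.descPochhammer_smeval_eq_prod_range] at h
  rw [add_comm x, h, Finset.Nat.sum_antidiagonal_eq_sum_range_succ_mk,
    Finset.range_eq_Ico, Finset.sum_eq_sum_Ico_succ_bot n.succ_pos]
  congr 1
  · simp
  · refine Finset.sum_congr (by ext; simp) fun k _ => ?_
    rw [Nat.descFactorial_eq_factorial_mul_choose]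
    push_cast
    ring
end

section
/- Let a, ad : (ℕ →₀ ℝ) →ₗ[ℝ] (ℕ →₀ ℝ) be the linear maps determined on the standard basis (e_m)_{m∈ℕ} of finitely supported real sequences by a e_m = √m · e_{m-1} (with a e_0 = 0) and ad e_m = √(m+1) · e_{m+1}. Then for every n ≥ 1 and every m ∈ ℕ, (a^n ∘ ad^n − ad^n ∘ a^n) e_m = (descFactorial(m+n, n) − descFactorial(m, n)) · e_m, where descFactorial(m, n) = m·(m-1)⋯(m-n+1) (equal to 0 when m < n). -/
/-- The `n`-th power of the annihilation operator sends `e_m` to `√(m (m-1) ⋯ (m-n+1)) • e_{m-n}`. -/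
theorem annihilation_pow_single (a : Module.End ℝ (ℕ →₀ ℝ))
    (ha : ∀ m : ℕ, a (Finsupp.single m 1) = Real.sqrt m • Finsupp.single (m - 1) 1) (n m : ℕ) :
    (a ^ n) (Finsupp.single m 1) =
      Real.sqrt (m.descFactorial n) • Finsupp.single (m - n) 1 := by
  induction n with
  | zero => simp
  | succ n ih =>
    rw [pow_succ', Module.End.mul_apply, ih, map_smul, ha, smul_smul, Nat.descFactorial_succ,
      Nat.cast_mul, Real.sqrt_mul (Nat.cast_nonneg _), mul_comm, Nat.sub_sub]

/-- The `n`-th power of the creation operator sends `e_m` to `√((m+n) ⋯ (m+1)) • e_{m+n}`. -/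
theorem creation_pow_single (ad : Module.End ℝ (ℕ →₀ ℝ))
    (had : ∀ m : ℕ, ad (Finsupp.single m 1) = Real.sqrt (m + 1) • Finsupp.single (m + 1) 1)
    (n m : ℕ) :
    (ad ^ n) (Finsupp.single m 1) =
      Real.sqrt ((m + n).descFactorial n) • Finsupp.single (m + n) 1 := by
  induction n with
  | zero => simp
  | succ n ih =>
    rw [pow_succ', Module.End.mul_apply, ih, map_smul, had, smul_smul, ← add_assoc,
      Nat.succ_descFactorial_succ, Nat.cast_mul, Real.sqrt_mul (Nat.cast_nonneg _), mul_comm,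
      Nat.cast_succ]


/-- Let `a, ad` be the annihilation and creation operators on the Fock space
`ℕ →₀ ℝ`, determined on the standard basis by `a e_m = √m • e_{m-1}`
(so `a e_0 = 0`) and `ad e_m = √(m+1) • e_{m+1}`. Then for every `n ≥ 1` and
every `m`, `(aⁿ ∘ adⁿ − adⁿ ∘ aⁿ) e_m = (descFactorial (m+n) n − descFactorial m n) • e_m`. -/
theorem commutator_diagonal_on_fock_basis
    (a ad : Module.End ℝ (ℕ →₀ ℝ))
    (ha : ∀ m : ℕ, a (Finsupp.single m 1) = Real.sqrt m • Finsupp.single (m - 1) 1)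
    (had : ∀ m : ℕ, ad (Finsupp.single m 1) = Real.sqrt (m + 1) • Finsupp.single (m + 1) 1)
    (n : ℕ) (hn : 1 ≤ n) (m : ℕ) :
    (a ^ n * ad ^ n - ad ^ n * a ^ n) (Finsupp.single m 1) =
      (((m + n).descFactorial n : ℝ) - (m.descFactorial n : ℝ)) • Finsupp.single m 1 := by
  rw [LinearMap.sub_apply, Module.End.mul_apply, Module.End.mul_apply,
    creation_pow_single ad had, annihilation_pow_single a ha, map_smul, map_smul,
    creation_pow_single ad had, annihilation_pow_single a ha, smul_smul, smul_smul,
    Nat.add_sub_cancel, Real.mul_self_sqrt (Nat.cast_nonneg _), sub_smul]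
  rcases le_or_gt n m with h | h
  · rw [Nat.sub_add_cancel h, Real.mul_self_sqrt (Nat.cast_nonneg _)]
  · simp [Nat.descFactorial_of_lt h]
end

section
/- Let a, ad : (ℕ →₀ ℝ) →ₗ[ℝ] (ℕ →₀ ℝ) be the linear maps determined on the standard basis (e_m)_{m∈ℕ} of finitely supported real sequences by a e_m = √m · e_{m-1} (with a e_0 = 0) and ad e_m = √(m+1) · e_{m+1}, and set Â_n = a^n ∘ ad^n − ad^n ∘ a^n. Then for every n ≥ 1 and every f : ℕ →₀ ℝ with f ≠ 0, one has ∑_{m} (Â_n f)(m) · f(m) > 0. -/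
/-- Powers of the creation operator on the Fock basis. -/
theorem creation_pow_apply_single (ad : Module.End ℝ (ℕ →₀ ℝ))
    (had : ∀ m : ℕ, ad (Finsupp.single m 1) = Real.sqrt (m + 1) • Finsupp.single (m + 1) 1)
    (n m : ℕ) :
    (ad ^ n) (Finsupp.single m 1) =
      Real.sqrt ((m + 1).ascFactorial n : ℕ) • Finsupp.single (m + n) 1 := by
  induction n with
  | zero => simp
  | succ n ih =>
    rw [pow_succ', Module.End.mul_apply, ih, map_smul, had, smul_smul,
      ← Real.sqrt_mul (Nat.cast_nonneg _), Nat.ascFactorial_succ]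
    congr 2
    push_cast
    ring

/-- Powers of the annihilation operator on the Fock basis. -/
theorem annihilation_pow_apply_single (a : Module.End ℝ (ℕ →₀ ℝ))
    (ha : ∀ m : ℕ, a (Finsupp.single m 1) = Real.sqrt m • Finsupp.single (m - 1) 1)
    (n m : ℕ) :
    (a ^ n) (Finsupp.single m 1) =
      Real.sqrt (m.descFactorial n : ℕ) • Finsupp.single (m - n) 1 := by
  induction n with
  | zero => simp
  | succ n ih =>
    rw [pow_succ', Module.End.mul_apply, ih, map_smul, ha, smul_smul,
      ← Real.sqrt_mul (Nat.cast_nonneg _), Nat.descFactorial_succ, Nat.sub_sub]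
    congr 2
    push_cast
    ring

/-- The commutator `[aⁿ, a†ⁿ]` is diagonal in the Fock basis. -/
theorem commutator_pow_apply (a ad : Module.End ℝ (ℕ →₀ ℝ))
    (ha : ∀ m : ℕ, a (Finsupp.single m 1) = Real.sqrt m • Finsupp.single (m - 1) 1)
    (had : ∀ m : ℕ, ad (Finsupp.single m 1) = Real.sqrt (m + 1) • Finsupp.single (m + 1) 1)
    (n : ℕ) (f : ℕ →₀ ℝ) (m : ℕ) :
    (a ^ n * ad ^ n - ad ^ n * a ^ n) f m =
      (((m + 1).ascFactorial n : ℕ) - (m.descFactorial n : ℕ) : ℝ) * f m := by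
  have basis (k : ℕ) : (a ^ n * ad ^ n - ad ^ n * a ^ n) (Finsupp.single k 1) =
      (((k + 1).ascFactorial n : ℕ) - (k.descFactorial n : ℕ) : ℝ) • Finsupp.single k 1 := by
    rw [LinearMap.sub_apply, Module.End.mul_apply, Module.End.mul_apply,
      creation_pow_apply_single ad had, annihilation_pow_apply_single a ha, map_smul, map_smul,
      creation_pow_apply_single ad had, annihilation_pow_apply_single a ha, smul_smul, smul_smul,
      Nat.add_descFactorial_eq_ascFactorial, Real.mul_self_sqrt (Nat.cast_nonneg _),
      Nat.add_sub_cancel, sub_smul]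
    congr 1
    rcases lt_or_ge k n with h | h
    · simp [Nat.descFactorial_of_lt h]
    · obtain ⟨j, rfl⟩ := Nat.exists_eq_add_of_le' h
      rw [Nat.add_sub_cancel, Nat.add_descFactorial_eq_ascFactorial,
        Real.mul_self_sqrt (Nat.cast_nonneg _)]
  induction f using Finsupp.induction_linear with
  | zero => simp
  | add f g hf hg => rw [map_add, Finsupp.add_apply, hf, hg, Finsupp.add_apply, mul_add]
  | single k c =>
    rw [← Finsupp.smul_single_one, map_smul, basis]
    by_cases h : k = m
    · subst h
      simp [mul_comm]
    · simp [h]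

theorem Nat.descFactorial_lt_succ_ascFactorial (m : ℕ) {n : ℕ} (hn : 1 ≤ n) :
    m.descFactorial n < (m + 1).ascFactorial n :=
  (Nat.descFactorial_le_pow m n).trans_lt <|
    (Nat.pow_lt_pow_left m.lt_succ_self (Nat.one_le_iff_ne_zero.mp hn)).trans_le <|
      Nat.pow_succ_le_ascFactorial (m + 1) n


/-- With `a, ad` the annihilation/creation operators on `ℕ →₀ ℝ` (determined on the
standard basis by `a e_m = √m • e_{m-1}`, so `a e_0 = 0`, and `ad e_m = √(m+1) • e_{m+1}`),
the commutator `Â_n = aⁿ ∘ adⁿ − adⁿ ∘ aⁿ` is strictly positive: for every `n ≥ 1` and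
every `f ≠ 0`, `⟨Â_n f, f⟩ = ∑_m (Â_n f) m · f m > 0`. -/
theorem commutator_strictly_positive
    (a ad : Module.End ℝ (ℕ →₀ ℝ))
    (ha : ∀ m : ℕ, a (Finsupp.single m 1) = Real.sqrt m • Finsupp.single (m - 1) 1)
    (had : ∀ m : ℕ, ad (Finsupp.single m 1) = Real.sqrt (m + 1) • Finsupp.single (m + 1) 1)
    (n : ℕ) (hn : 1 ≤ n) (f : ℕ →₀ ℝ) (hf : f ≠ 0) :
    0 < ((a ^ n * ad ^ n - ad ^ n * a ^ n) f).sum fun m c => c * f m := by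
  have gap (m : ℕ) : (0 : ℝ) < ((m + 1).ascFactorial n : ℕ) - (m.descFactorial n : ℕ) :=
    sub_pos.mpr (Nat.cast_lt.mpr (Nat.descFactorial_lt_succ_ascFactorial m hn))
  have diag := commutator_pow_apply a ad ha had n f
  refine Finset.sum_pos (fun m hm => ?_) ?_
  · have h := Finsupp.mem_support_iff.mp hm
    rw [diag] at h
    dsimp only
    rw [diag, mul_assoc]
    exact mul_pos (gap m) (mul_self_pos.mpr (right_ne_zero_of_mul h))
  · obtain ⟨m, hm⟩ := Finsupp.ne_iff.mp hf
    refine ⟨m, Finsupp.mem_support_iff.mpr ?_⟩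
    rw [diag]
    exact mul_ne_zero (gap m).ne' hm
end

section
/- Let a, ad : (ℕ →₀ ℝ) →ₗ[ℝ] (ℕ →₀ ℝ) be the linear maps determined on the standard basis (e_m)_{m∈ℕ} of finitely supported real sequences by a e_m = √m · e_{m-1} (with a e_0 = 0) and ad e_m = √(m+1) · e_{m+1}, and let N = ad ∘ a. Then a⁴ ∘ ad⁴ − ad⁴ ∘ a⁴ = 16 • (N ∘ N ∘ N) + 24 • (N ∘ N) + 56 • N + 24 • id as linear endomorphisms of ℕ →₀ ℝ. -/
/-- In a ring, the canonical commutation relation gives `N bᵏ = bᵏ (N + k)` for `N = b a`. -/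
theorem mul_pow_creation_of_ccr {R : Type*} [Ring R] {a b : R} (h : a * b = b * a + 1) (k : ℕ) :
    b * a * b ^ k = b ^ k * (b * a + k) := by
  induction k with
  | zero => simp
  | succ k ih =>
    have hb : (b * a + (k : R)) * b = b * (b * a + (k + 1 : R)) := by
      rw [add_mul, mul_assoc, h, (Nat.cast_commute k b).eq]
      noncomm_ring
    rw [pow_succ, ← mul_assoc, ih, mul_assoc, hb, Nat.cast_succ, mul_assoc]

/-- In a ring, the canonical commutation relation gives `N aᵏ = aᵏ (N - k)` for `N = b a`. -/
theorem mul_pow_annihilation_of_ccr {R : Type*} [Ring R] {a b : R} (h : a * b = b * a + 1)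
    (k : ℕ) : b * a * a ^ k = a ^ k * (b * a - k) := by
  induction k with
  | zero => simp
  | succ k ih =>
    have ha : (b * a - (k : R)) * a = a * (b * a - (k + 1 : R)) := by
      have h' : a * (b * a) = b * a * a + a := by rw [← mul_assoc, h, add_mul, one_mul]
      rw [sub_mul, mul_sub, h', (Nat.cast_commute k a).eq]
      noncomm_ring
    rw [pow_succ, ← mul_assoc, ih, mul_assoc, ha, Nat.cast_succ, mul_assoc]

theorem pow_succ_mul_pow_succ_of_ccr {R : Type*} [Ring R] {a b : R} (h : a * b = b * a + 1)
    (k : ℕ) : a ^ (k + 1) * b ^ (k + 1) = a ^ k * b ^ k * (b * a + k + 1) := by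
  calc a ^ (k + 1) * b ^ (k + 1) = a ^ k * ((a * b) * b ^ k) := by
        rw [pow_succ a, pow_succ' b]; simp only [mul_assoc]
    _ = a ^ k * b ^ k * (b * a + k + 1) := by
        rw [h, add_mul, mul_pow_creation_of_ccr h, one_mul, mul_assoc, mul_add _ (_ + _), mul_one]

theorem pow_succ_mul_pow_succ_of_ccr' {R : Type*} [Ring R] {a b : R} (h : a * b = b * a + 1)
    (k : ℕ) : b ^ (k + 1) * a ^ (k + 1) = b ^ k * a ^ k * (b * a - k) := by
  rw [mul_assoc, ← mul_pow_annihilation_of_ccr h, pow_succ b, pow_succ' a]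
  simp only [mul_assoc]

theorem commutator_pow_four_of_ccr {R : Type*} [Ring R] {a b : R} (h : a * b = b * a + 1) :
    a ^ 4 * b ^ 4 - b ^ 4 * a ^ 4 =
      16 • ((b * a) * (b * a) * (b * a)) + 24 • ((b * a) * (b * a)) + 56 • (b * a) +
        24 • (1 : R) := by
  have hanti : a ^ 4 * b ^ 4 = (b * a + 1) * (b * a + 2) * (b * a + 3) * (b * a + 4) := by
    simp only [pow_succ_mul_pow_succ_of_ccr h, pow_zero, one_mul]
    norm_num [add_assoc]
  have hnorm : b ^ 4 * a ^ 4 = b * a * (b * a - 1) * (b * a - 2) * (b * a - 3) := by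
    simp only [pow_succ_mul_pow_succ_of_ccr' h, pow_zero, one_mul]
    norm_num
  rw [hanti, hnorm]
  generalize b * a = N
  have h2 : (2 : R) = 1 + 1 := by norm_num
  have h3 : (3 : R) = 1 + 1 + 1 := by norm_num
  have h4 : (4 : R) = 1 + 1 + 1 + 1 := by norm_num
  rw [h2, h3, h4]
  simp only [mul_sub, sub_mul, mul_add, add_mul, mul_one, one_mul]
  abel

theorem annihilation_mul_creation (a ad : Module.End ℝ (ℕ →₀ ℝ))
    (ha : ∀ m : ℕ, a (Finsupp.single m 1) = Real.sqrt m • Finsupp.single (m - 1) 1)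
    (had : ∀ m : ℕ, ad (Finsupp.single m 1) = Real.sqrt (m + 1) • Finsupp.single (m + 1) 1) :
    a * ad = ad * a + 1 := by
  refine Finsupp.lhom_ext' fun m => LinearMap.ext_ring ?_
  simp only [LinearMap.comp_apply, Finsupp.lsingle_apply, Module.End.mul_apply,
    LinearMap.add_apply, Module.End.one_apply, ha, had, map_smul, smul_smul]
  have hm : √((m : ℝ) + 1) * √((m : ℝ) + 1) = m + 1 := Real.mul_self_sqrt (by positivity)
  rcases m with _ | n
  · simp
  · have hn : √((n : ℝ) + 1) * √((n : ℝ) + 1) = n + 1 := Real.mul_self_sqrt (by positivity)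
    push_cast at hm ⊢
    simp only [hm, hn]
    rw [add_smul _ (1 : ℝ), one_smul]


/-- With `a, ad` the annihilation/creation operators on `ℕ →₀ ℝ` and `N = ad ∘ a`
the number operator, `Â_4 = a⁴ ∘ ad⁴ − ad⁴ ∘ a⁴ = 16 N³ + 24 N² + 56 N + 24 id`. -/
theorem commutator_four
    (a ad : Module.End ℝ (ℕ →₀ ℝ))
    (ha : ∀ m : ℕ, a (Finsupp.single m 1) = Real.sqrt m • Finsupp.single (m - 1) 1)
    (had : ∀ m : ℕ, ad (Finsupp.single m 1) = Real.sqrt (m + 1) • Finsupp.single (m + 1) 1) :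
    a ^ 4 * ad ^ 4 - ad ^ 4 * a ^ 4 =
      (16 : ℝ) • ((ad * a) * (ad * a) * (ad * a)) +
        (24 : ℝ) • ((ad * a) * (ad * a)) + (56 : ℝ) • (ad * a) +
          (24 : ℝ) • (1 : Module.End ℝ (ℕ →₀ ℝ)) := by
  simpa only [ofNat_smul_eq_nsmul] using
    commutator_pow_four_of_ccr (R := Module.End ℝ (ℕ →₀ ℝ))
      (annihilation_mul_creation a ad ha had)
end
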